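/- arXiv:0909.5045 — 2 statements merged into one kernel-verified Lean document; each statement's English description precedes it below -/
import Mathlib

section
/- Let X be a type of terms whose reduction relation →_X is the union of two relations →₁ and →₂, let P be a subset of X (the 'pure' terms) equipped with a reduction relation →_p, let T, T' be typability predicates on P and X respectively, let Ateb : X → P be a function, and let R be a binary relation on X. Assume: (i) every T-typable pure term is strongly normalizing for →_p; (ii) PSN holds: every pure term strongly normalizing for →_p is strongly normalizing for →_X; (iii) for every T'-typable t, Ateb(t) is T-typable; (iv) →₁ is strongly normalizing; (v) initialization: for every T'-typable term t there exists u with Ateb(t) →_X* u and u R t; (vi) simulation*: whenever t →₁ t' and u R t, there exists u' with u →_X* u' and u' R t'; (vii) simulation⁺: whenever t →₂ t' and u R t, there exists u' with u →_X⁺ u' and u' R t'. Then every T'-typable term of X is strongly normalizing for →_X. -/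
/-- A term is strongly normalizing for a relation `r` if it is accessible
under the converse of `r` (no infinite reduction sequence starts from it). -/
def SN {X : Type*} (r : X → X → Prop) (t : X) : Prop :=
  Acc (fun a b => r b a) t

/-- If `t` is simulated by some reduct `v` of a term `u` that is strongly normalizing for `redX`,
where `red1`-steps are simulated by `redX*` and `red2`-steps by `redX⁺`, and `red1` is strongly
normalizing, then `t` is strongly normalizing for the union of `red1` and `red2`. -/
theorem SN.of_simulation {X Y : Type*} {red1 red2 redY : Y → Y → Prop} {redX : X → X → Prop}
    {R : X → Y → Prop} (hUnion : ∀ a b, redY a b → red1 a b ∨ red2 a b)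
    (hSN1 : ∀ t, SN red1 t)
    (hSimStar : ∀ t t' u, red1 t t' → R u t →
      ∃ u', Relation.ReflTransGen redX u u' ∧ R u' t')
    (hSimPlus : ∀ t t' u, red2 t t' → R u t →
      ∃ u', Relation.TransGen redX u u' ∧ R u' t')
    {u : X} (hu : SN redX u) :
    ∀ {v t}, Relation.ReflTransGen redX u v → R v t → SN redY t := by
  induction Acc.transGen hu with
  | intro u _ ihu =>
    intro v t huv hvt
    induction hSN1 t generalizing v with
    | intro t _ iht =>
      refine Acc.intro t fun t' htt' => ?_
      rcases hUnion t t' htt' with h1 | h2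
      · obtain ⟨v', hvv', hv't'⟩ := hSimStar t t' v h1 hvt
        exact iht t' h1 (huv.trans hvv') hv't'
      · obtain ⟨v', hvv', hv't'⟩ := hSimPlus t t' v h2 hvt
        have huv' : Relation.TransGen redX u v' := Relation.TransGen.trans_right huv hvv'
        have hacc : SN redX v' :=
          Acc.inv_of_transGen hu huv'.swap
        exact ihu v' huv'.swap hacc .refl hv't'

/-- The abstract "simulation proof" technique: SN from PSN via an expansion
function `Ateb` and a simulation relation `R`.
* the reduction `redX` of the full calculus is the union of `red1` and `red2`,
* `Pure` is the set of pure terms, with reduction `redP`,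
* `T` is typability of pure terms, `T'` typability of terms of the full calculus. -/
theorem simulation_proof_SN_from_PSN
    {X : Type*} (red1 red2 : X → X → Prop)
    (Pure : X → Prop) (redP : X → X → Prop)
    (T : X → Prop) (T' : X → Prop)
    -- the full reduction is the union of red1 and red2
    (redX : X → X → Prop) (hUnion : ∀ a b, redX a b ↔ red1 a b ∨ red2 a b)
    -- (i) every T-typable pure term is strongly normalizing for redP
    (hTypedSN : ∀ p, Pure p → T p → SN redP p)
    -- (ii) PSN
    (hPSN : ∀ p, Pure p → SN redP p → SN redX p)
    -- Ateb maps into the pure terms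
    (Ateb : X → X) (hAtebPure : ∀ t, Pure (Ateb t))
    -- (iii) preservation of typability
    (hType : ∀ t, T' t → T (Ateb t))
    -- (iv) red1 is strongly normalizing
    (hSN1 : ∀ t, SN red1 t)
    (R : X → X → Prop)
    -- (v) initialization
    (hInit : ∀ t, T' t → ∃ u, Relation.ReflTransGen redX (Ateb t) u ∧ R u t)
    -- (vi) simulation *
    (hSimStar : ∀ t t' u, red1 t t' → R u t →
      ∃ u', Relation.ReflTransGen redX u u' ∧ R u' t')
    -- (vii) simulation +
    (hSimPlus : ∀ t t' u, red2 t t' → R u t →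
      ∃ u', Relation.TransGen redX u u' ∧ R u' t') :
    ∀ t, T' t → SN redX t := by
  intro t ht
  obtain ⟨u, hu, hR⟩ := hInit t ht
  have hSN : SN redX (Ateb t) :=
    hPSN _ (hAtebPure t) (hTypedSN _ (hAtebPure t) (hType t ht))
  exact SN.of_simulation (fun a b => (hUnion a b).1) hSN1 hSimStar hSimPlus hSN hu hR
end

section
/- For every λwsn-term t, typing environment Γ and simple type A: if Γ ⊢ t : A in the λwsn typing system, then Γ ⊢ Ateb(t) : A; moreover Ateb(t) contains no explicit substitutions. -/
namespace LambdaWSN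

/-- Simple types. -/
inductive Ty : Type
  | base : Ty
  | arrow : Ty → Ty → Ty

/-- Terms of the λwsn-calculus: variables, application, abstraction,
explicit substitution `esub t x u G D` standing for `t[x,u,Γ,Δ]`, and
explicit weakening `weak G t` standing for `Γt`. -/
inductive Tm : Type
  | var : ℕ → Tm
  | app : Tm → Tm → Tm
  | lam : ℕ → Tm → Tm
  | esub : Tm → ℕ → Tm → Finset ℕ → Finset ℕ → Tm
  | weak : Finset ℕ → Tm → Tm

/-- Terms containing no explicit substitution (λ-terms with explicit
weakening). -/
inductive NoSub : Tm → Prop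
  | var (x : ℕ) : NoSub (.var x)
  | app {t u : Tm} : NoSub t → NoSub u → NoSub (.app t u)
  | lam {t : Tm} (x : ℕ) : NoSub t → NoSub (.lam x t)
  | weak {t : Tm} (G : Finset ℕ) : NoSub t → NoSub (.weak G t)

/-- Typing environments: sets of typed variables, as partial functions. -/
abbrev Env := ℕ → Option Ty

/-- `restr Γ Δ` is `Γ ∖ Δ`: the environment `Γ` with the variables of the set
`Δ` removed. -/
def restr (Γ : Env) (Δ : Finset ℕ) : Env := fun y => if y ∈ Δ then none else Γ y

/-- `Δ ⊆ Γ` : every variable of the set `Δ` is declared in the environment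
`Γ`. -/
def subEnv (Δ : Finset ℕ) (Γ : Env) : Prop := ∀ x ∈ Δ, (Γ x).isSome

/-- The typing system of the λwsn-calculus. -/
inductive Typing : Env → Tm → Ty → Prop
  | ax (x : ℕ) (A : Ty) :
      Typing (fun y => if y = x then some A else none) (.var x) A
  | weak {Γ : Env} {Δ : Finset ℕ} {t : Tm} {A : Ty} :
      Typing (restr Γ Δ) t A → subEnv Δ Γ → Typing Γ (.weak Δ t) A
  | app {Γ : Env} {t u : Tm} {A B : Ty} :
      Typing Γ t (.arrow B A) → Typing Γ u B → Typing Γ (.app t u) A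
  | lam {Γ : Env} {t : Tm} {x : ℕ} {A B : Ty} :
      Typing (Function.update Γ x (some B)) t A →
      Typing Γ (.lam x t) (.arrow B A)
  | sub {P : Env} {t u : Tm} {x : ℕ} {G D : Finset ℕ} {A B : Ty} :
      Typing (restr P G) u A →
      Typing (Function.update (restr P D) x (some A)) t B →
      subEnv (G ∪ D) P →
      Typing P (.esub t x u G D) B

/-- The expansion `Ateb`, mapping λwsn-terms to λ-terms with explicit
weakening: `Ateb (t[x,u,Γ,Δ]) = (Δ(λx.Ateb t)) (Γ (Ateb u))`. -/
def Ateb : Tm → Tm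
  | .var x => .var x
  | .app t u => .app (Ateb t) (Ateb u)
  | .lam x t => .lam x (Ateb t)
  | .weak G t => .weak G (Ateb t)
  | .esub t x u G D => .app (.weak D (.lam x (Ateb t))) (.weak G (Ateb u))

/-- The expansion of any term, typable or not, contains no explicit substitution. -/
theorem noSub_Ateb (t : Tm) : NoSub (Ateb t) := by
  induction t with
  | var x => exact .var x
  | app t u iht ihu => exact .app iht ihu
  | lam x t ih => exact .lam x ih
  | esub t x u G D iht ihu => exact .app (.weak D (.lam x iht)) (.weak G ihu)
  | weak G t ih => exact .weak G ih

/-- The expansion preserves typing. -/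
theorem Typing.ateb {Γ : Env} {t : Tm} {A : Ty} (h : Typing Γ t A) : Typing Γ (Ateb t) A := by
  induction h with
  | ax x A => exact .ax x A
  | weak _ hs ih => exact .weak ih hs
  | app _ _ iht ihu => exact .app iht ihu
  | lam _ ih => exact .lam ih
  | sub _ _ hs ihu iht =>
    exact .app (.weak (.lam iht) fun y hy => hs y (Finset.mem_union_right _ hy))
      (.weak ihu fun y hy => hs y (Finset.mem_union_left _ hy))

/-- If `Γ ⊢ t : A` in λwsn then `Γ ⊢ Ateb t : A`, and `Ateb t` contains no
explicit substitutions. -/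
theorem Ateb_typing :
    ∀ (Γ : Env) (t : Tm) (A : Ty), Typing Γ t A →
      Typing Γ (Ateb t) A ∧ NoSub (Ateb t) :=
  fun _ t _ h => ⟨h.ateb, noSub_Ateb t⟩

end LambdaWSN
end
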